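/- arXiv:2501.06610 — 3 statements merged into one kernel-verified Lean document; each statement's English description precedes it below -/
import Mathlib

section
/- Let d ≥ 1, let F : ℝ^d → ℝ be twice continuously differentiable with M-Lipschitz Hessian, let ν > 0 and x ∈ ℝ^d. Let (Θ, P) be a probability space and for each θ ∈ Θ let (u_1(θ), …, u_d(θ)) be an orthonormal basis of ℝ^d, measurably in θ. Define b_j(θ) := (F(x + νu_j(θ)) − F(x − νu_j(θ)))/(2ν) and G(θ) := ∑_{j=1}^d b_j(θ) u_j(θ). Then the bias of the randomized-subspace central finite-difference gradient estimator satisfies ‖E_θ[G(θ)] − ∇F(x)‖² ≤ d M² ν⁴ / 36. -/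
open MeasureTheory
open scoped RealInnerProductSpace

section CentralDifference

variable {E : Type*} [NormedAddCommGroup E] [NormedSpace ℝ E]

/-- The derivative of a function vanishing at `0` controls the function by comparison on `[0, a]`. -/
theorem abs_le_of_abs_deriv_le {g g' B B' : ℝ → ℝ} {a : ℝ} (ha : 0 ≤ a) (hg0 : g 0 = 0)
    (hB0 : B 0 = 0) (hg : ∀ t, HasDerivAt g (g' t) t) (hB : ∀ t, HasDerivAt B (B' t) t)
    (h : ∀ t, 0 ≤ t → |g' t| ≤ B' t) : |g a| ≤ B a := by
  have := image_norm_le_of_norm_deriv_right_le_deriv_boundary (f := g) (f' := g') (a := 0)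
    (b := a) (B := B) (B' := B') (fun t _ => (hg t).continuousAt.continuousWithinAt)
    (fun t _ => (hg t).hasDerivWithinAt) (by simp [hg0, hB0]) hB (fun t ht => h t ht.1)
    (x := a) ⟨ha, le_rfl⟩
  exact this

/-- Third-order error bound for the symmetric difference along a line, for a function with
Lipschitz second derivative. -/
theorem abs_symm_diff_sub_fderiv_le {F : E → ℝ} {M : ℝ} (hF : ContDiff ℝ 2 F)
    (hLip : ∀ x y, ‖iteratedFDeriv ℝ 2 F x - iteratedFDeriv ℝ 2 F y‖ ≤ M * ‖x - y‖)
    (x v : E) (hv : ‖v‖ = 1) {ν : ℝ} (hν : 0 ≤ ν) :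
    |F (x + ν • v) - F (x - ν • v) - 2 * ν * fderiv ℝ F x v| ≤ M * ν ^ 3 / 3 := by
  have hF' : ContDiff ℝ 1 (fderiv ℝ F) := hF.fderiv_right (by norm_num)
  have hline : ∀ t : ℝ, HasDerivAt (fun t : ℝ => x + t • v) v t := fun t => by
    simpa using ((hasDerivAt_id t).smul_const v).const_add x
  have hline' : ∀ t : ℝ, HasDerivAt (fun t : ℝ => x - t • v) (-v) t := fun t => by
    simpa using ((hasDerivAt_id t).smul_const v).const_sub x
  have hd : ∀ y, HasFDerivAt F (fderiv ℝ F y) y := fun y =>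
    (hF.differentiable (by norm_num) y).hasFDerivAt
  have hdv : ∀ y, HasFDerivAt (fun z => fderiv ℝ F z v) ((fderiv ℝ (fderiv ℝ F) y).flip v) y := by
    intro y
    have h := (hF'.differentiable (by norm_num) y).hasFDerivAt
    refine (h.clm_apply (hasFDerivAt_const v y)).congr_fderiv ?_
    simp
  have hsnd : ∀ t : ℝ, 0 ≤ t → |fderiv ℝ (fderiv ℝ F) (x + t • v) v v
      - fderiv ℝ (fderiv ℝ F) (x - t • v) v v| ≤ M * (2 * t) := by
    intro t ht
    have h1 := (iteratedFDeriv ℝ 2 F (x + t • v)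
      - iteratedFDeriv ℝ 2 F (x - t • v)).le_opNorm ![v, v]
    have h2 := hLip (x + t • v) (x - t • v)
    have h3 : x + t • v - (x - t • v) = (2 * t) • v := by module
    rw [h3, norm_smul, hv, mul_one, Real.norm_of_nonneg (by positivity)] at h2
    simp only [sub_apply, iteratedFDeriv_two_apply, Fin.prod_univ_two,
      Matrix.cons_val_zero, Matrix.cons_val_one, hv, mul_one, Real.norm_eq_abs] at h1
    exact h1.trans h2
  have hfst : ∀ t : ℝ, 0 ≤ t → |fderiv ℝ F (x + t • v) v + fderiv ℝ F (x - t • v) v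
      - 2 * fderiv ℝ F x v| ≤ M * t ^ 2 := by
    intro t ht
    refine abs_le_of_abs_deriv_le (B := fun t => M * t ^ 2) (B' := fun t => M * (2 * t))
      (g := fun t => fderiv ℝ F (x + t • v) v + fderiv ℝ F (x - t • v) v - 2 * fderiv ℝ F x v)
      ht (by simp; ring) (by simp) (fun s => ?_) (fun s => ?_) hsnd
    · have h1 : HasDerivAt (fun s : ℝ => fderiv ℝ F (x + s • v) v)
          ((fderiv ℝ (fderiv ℝ F) (x + s • v)).flip v v) s :=
        HasFDerivAt.comp_hasDerivAt (l := fun z => fderiv ℝ F z v) s (hdv (x + s • v)) (hline s)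
      have h2 : HasDerivAt (fun s : ℝ => fderiv ℝ F (x - s • v) v)
          ((fderiv ℝ (fderiv ℝ F) (x - s • v)).flip v (-v)) s :=
        HasFDerivAt.comp_hasDerivAt (l := fun z => fderiv ℝ F z v) s (hdv (x - s • v)) (hline' s)
      refine ((h1.add h2).sub_const (2 * fderiv ℝ F x v)).congr_deriv ?_
      simp [sub_eq_add_neg]
    · simpa using (hasDerivAt_pow 2 s).const_mul M
  refine abs_le_of_abs_deriv_le (B := fun t => M * t ^ 3 / 3) (B' := fun t => M * t ^ 2)
    (g := fun t => F (x + t • v) - F (x - t • v) - 2 * t * fderiv ℝ F x v)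
    hν (by simp) (by simp) (fun s => ?_) (fun s => ?_) hfst
  · have h1 : HasDerivAt (fun s : ℝ => F (x + s • v)) (fderiv ℝ F (x + s • v) v) s :=
      (hd (x + s • v)).comp_hasDerivAt s (hline s)
    have h2 : HasDerivAt (fun s : ℝ => F (x - s • v)) (fderiv ℝ F (x - s • v) (-v)) s :=
      (hd (x - s • v)).comp_hasDerivAt s (hline' s)
    have h3 := ((hasDerivAt_id s).const_mul 2).mul_const (fderiv ℝ F x v)
    refine ((h1.sub h2).sub h3).congr_deriv ?_
    simp
  · refine (((hasDerivAt_pow 3 s).const_mul M).div_const 3).congr_deriv ?_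
    norm_num
    ring

/-- Second-order error bound for the central finite-difference quotient. -/
theorem abs_central_diff_sub_fderiv_le {F : E → ℝ} {M : ℝ} (hF : ContDiff ℝ 2 F)
    (hLip : ∀ x y, ‖iteratedFDeriv ℝ 2 F x - iteratedFDeriv ℝ 2 F y‖ ≤ M * ‖x - y‖)
    (x v : E) (hv : ‖v‖ = 1) {ν : ℝ} (hν : 0 < ν) :
    |(F (x + ν • v) - F (x - ν • v)) / (2 * ν) - fderiv ℝ F x v| ≤ M * ν ^ 2 / 6 := by
  have h := abs_symm_diff_sub_fderiv_le hF hLip x v hv hν.le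
  have h2 : (0 : ℝ) < 2 * ν := by positivity
  rw [div_sub' h2.ne', abs_div, abs_of_pos h2, div_le_iff₀ h2]
  exact h.trans_eq (by ring)

end CentralDifference

/-- A full orthonormal family reconstructs a vector up to the error in its coordinates. -/
theorem Orthonormal.norm_sum_smul_sub_sq_le {ι E : Type*} [Fintype ι] [NormedAddCommGroup E]
    [InnerProductSpace ℝ E] [FiniteDimensional ℝ E] {v : ι → E} (hv : Orthonormal ℝ v)
    (hcard : Fintype.card ι = Module.finrank ℝ E) (c : ι → ℝ) (w : E) {ε : ℝ}
    (h : ∀ i, |c i - ⟪v i, w⟫| ≤ ε) :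
    ‖∑ i, c i • v i - w‖ ^ 2 ≤ Fintype.card ι * ε ^ 2 := by
  let e := OrthonormalBasis.mk hv
    (hv.linearIndependent.span_eq_top_of_card_eq_finrank' hcard).ge
  have he : ∀ i, e i = v i := fun i => by simp [e]
  have hw : ∑ i, ⟪v i, w⟫ • v i = w := by simpa only [he] using e.sum_repr' w
  have hdiff : ∑ i, c i • v i - w = ∑ i, (c i - ⟪v i, w⟫) • v i := by
    simp only [sub_smul, Finset.sum_sub_distrib, hw]
  rw [hdiff, ← real_inner_self_eq_norm_sq, hv.inner_sum]
  calc _ ≤ ∑ _i : ι, ε ^ 2 := Finset.sum_le_sum fun i _ => by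
        simpa [sq] using sq_le_sq' (abs_le.mp (h i)).1 (abs_le.mp (h i)).2
    _ = _ := by simp

theorem randomized_central_diff_bias_bound
    (d : ℕ) (hd : 1 ≤ d)
    (F : EuclideanSpace ℝ (Fin d) → ℝ) (M : ℝ) (hM : 0 ≤ M)
    (hF : ContDiff ℝ 2 F)
    (hLip : ∀ x y : EuclideanSpace ℝ (Fin d),
      ‖iteratedFDeriv ℝ 2 F x - iteratedFDeriv ℝ 2 F y‖ ≤ M * ‖x - y‖)
    (ν : ℝ) (hν : 0 < ν) (x : EuclideanSpace ℝ (Fin d))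
    {Θ : Type*} [MeasurableSpace Θ] (P : Measure Θ) [IsProbabilityMeasure P]
    (u : Θ → Fin d → EuclideanSpace ℝ (Fin d))
    (hu : ∀ θ, Orthonormal ℝ (u θ))
    (b : Fin d → Θ → ℝ)
    (hb : ∀ j θ, b j θ = (F (x + ν • u θ j) - F (x - ν • u θ j)) / (2 * ν))
    (G : Θ → EuclideanSpace ℝ (Fin d))
    (hG : ∀ θ, G θ = ∑ j : Fin d, b j θ • u θ j)
    (hGint : Integrable G P) :
    ‖(∫ θ, G θ ∂P) - gradient F x‖ ^ 2 ≤ d * M ^ 2 * ν ^ 4 / 36 := by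
  have hpt : ∀ θ, ‖G θ - gradient F x‖ ^ 2 ≤ d * (M * ν ^ 2 / 6) ^ 2 := by
    intro θ
    have := (hu θ).norm_sum_smul_sub_sq_le (by simp) (fun j => b j θ) (gradient F x)
      (ε := M * ν ^ 2 / 6) fun j => by
        rw [hb, real_inner_comm, inner_gradient_left]
        exact abs_central_diff_sub_fderiv_le hF hLip x _ ((hu θ).norm_eq_one j) hν
    simpa [hG] using this
  have hint : ∫ θ, G θ ∂P - gradient F x = ∫ θ, (G θ - gradient F x) ∂P := by
    rw [integral_sub hGint (integrable_const _)]
    simp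
  have hnorm : ‖∫ θ, (G θ - gradient F x) ∂P‖ ≤ √(d * (M * ν ^ 2 / 6) ^ 2) := by
    simpa using norm_integral_le_of_norm_le_const (μ := P)
      (Filter.Eventually.of_forall fun θ => Real.le_sqrt_of_sq_le (hpt θ))
  calc ‖(∫ θ, G θ ∂P) - gradient F x‖ ^ 2
      ≤ √(d * (M * ν ^ 2 / 6) ^ 2) ^ 2 := by rw [hint]; gcongr
    _ = d * M ^ 2 * ν ^ 4 / 36 := by rw [Real.sq_sqrt (by positivity)]; ring
end

section
/- Let d ≥ 1, let (Ω, μ) be a probability space and f : ℝ^d × Ω → ℝ be such that for every ω the function f(·, ω) is twice continuously differentiable with M_f-Lipschitz Hessian; let F : ℝ^d → ℝ be twice continuously differentiable with M_F-Lipschitz Hessian where M_F ≤ M_f; assume E_ω[∇f(x, ω)] = ∇F(x) and E_ω[‖∇f(x, ω) − ∇F(x)‖²] ≤ β₁‖∇F(x)‖² + β₂ for constants β₁, β₂ ≥ 0. Fix x ∈ ℝ^d, ν > 0, θ > 0 and ε' > 0, and define ∇^{FD}h(x) := ∑_{j=1}^d ((h(x + νe_j) − h(x − νe_j))/(2ν))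 e_j. If ‖∇^{FD}F(x)‖² > ε', then the adaptive sample size satisfies ⌈ E_ω[‖∇^{FD}f(·, ω)(x) − ∇^{FD}F(x)‖²] / (θ² ‖∇^{FD}F(x)‖²) ⌉ ≤ (1 + 4β₁/θ²) + (2β₂/θ² + (2 + β₁) M_f² ν⁴ d / (9θ²)) / ε'. -/
open MeasureTheory

/-- The central finite-difference gradient estimator of `h` at `x` with sampling
radius `ν`, built from the canonical orthonormal basis of `EuclideanSpace ℝ (Fin d)`. -/
noncomputable def centralFDGrad (d : ℕ) (ν : ℝ) (h : EuclideanSpace ℝ (Fin d) → ℝ)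
    (x : EuclideanSpace ℝ (Fin d)) : EuclideanSpace ℝ (Fin d) :=
  ∑ j : Fin d,
    ((h (x + ν • EuclideanSpace.single j (1 : ℝ)) - h (x - ν • EuclideanSpace.single j (1 : ℝ)))
        / (2 * ν)) • EuclideanSpace.single j (1 : ℝ)

/-- One-sided third-order error estimate for the central difference on the line. -/
theorem central_difference_le {g g' g'' : ℝ → ℝ} {M ν : ℝ} (hν : 0 < ν)
    (hg : ∀ t, HasDerivAt g (g' t) t) (hg' : ∀ t, HasDerivAt g' (g'' t) t)
    (hlip : ∀ s t, |g'' s - g'' t| ≤ M * |s - t|) :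
    g ν - g (-ν) - 2 * ν * g' 0 ≤ M * ν ^ 3 / 3 := by
  have h1 : ∀ t, HasDerivAt (fun t => g t - g (-t) - 2 * t * g' 0 - M * t ^ 3 / 3)
      (g' t + g' (-t) - 2 * g' 0 - M * t ^ 2) t := by
    intro t
    refine ((((hg t).sub ((hg (-t)).comp t (hasDerivAt_neg t))).sub
      (((hasDerivAt_id t).const_mul 2).mul_const (g' 0))).sub
      (((hasDerivAt_pow 3 t).const_mul M).div_const 3)).congr_deriv ?_
    push_cast
    ring
  have h2 : ∀ t, HasDerivAt (fun t => g' t + g' (-t) - 2 * g' 0 - M * t ^ 2)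
      (g'' t - g'' (-t) - 2 * M * t) t := by
    intro t
    refine ((((hg' t).add ((hg' (-t)).comp t (hasDerivAt_neg t))).sub_const (2 * g' 0)).sub
      ((hasDerivAt_pow 2 t).const_mul M)).congr_deriv ?_
    push_cast
    ring
  have a2 : AntitoneOn (fun t => g' t + g' (-t) - 2 * g' 0 - M * t ^ 2) (Set.Ici 0) := by
    refine antitoneOn_of_deriv_nonpos (convex_Ici 0)
      (fun t _ => (h2 t).continuousAt.continuousWithinAt)
      (fun t _ => (h2 t).differentiableAt.differentiableWithinAt) fun t ht => ?_
    rw [interior_Ici, Set.mem_Ioi] at ht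
    rw [(h2 t).deriv]
    have h := (le_abs_self _).trans (hlip t (-t))
    rw [abs_of_pos (by linarith)] at h
    linarith
  have a1 : AntitoneOn (fun t => g t - g (-t) - 2 * t * g' 0 - M * t ^ 3 / 3) (Set.Ici 0) := by
    refine antitoneOn_of_deriv_nonpos (convex_Ici 0)
      (fun t _ => (h1 t).continuousAt.continuousWithinAt)
      (fun t _ => (h1 t).differentiableAt.differentiableWithinAt) fun t ht => ?_
    rw [interior_Ici, Set.mem_Ioi] at ht
    rw [(h1 t).deriv]
    have h := a2 (Set.mem_Ici.2 le_rfl) (Set.mem_Ici.2 ht.le) ht.le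
    simp only [neg_zero] at h
    linarith
  have h := a1 (Set.mem_Ici.2 le_rfl) (Set.mem_Ici.2 hν.le) hν.le
  simp only [neg_zero] at h
  linarith

/-- Error of the central difference quotient along a unit vector. -/
theorem abs_central_quotient_sub_fderiv_le {E : Type*} [NormedAddCommGroup E] [NormedSpace ℝ E]
    {h : E → ℝ} {M ν : ℝ} (hν : 0 < ν) (hh : ContDiff ℝ 2 h)
    (hlip : ∀ x y, ‖iteratedFDeriv ℝ 2 h x - iteratedFDeriv ℝ 2 h y‖ ≤ M * ‖x - y‖)
    (x e : E) (he : ‖e‖ = 1) :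
    |(h (x + ν • e) - h (x - ν • e)) / (2 * ν) - fderiv ℝ h x e| ≤ M * ν ^ 2 / 6 := by
  have hl : ∀ t : ℝ, HasDerivAt (fun t : ℝ => x + t • e) e t := fun t => by
    simpa using ((hasDerivAt_id t).smul_const e).const_add x
  have hg : ∀ t : ℝ, HasDerivAt (fun t : ℝ => h (x + t • e)) (fderiv ℝ h (x + t • e) e) t :=
    fun t => ((hh.differentiable (by norm_num)) _).hasFDerivAt.comp_hasDerivAt t (hl t)
  have hd : Differentiable ℝ (fderiv ℝ h) :=
    (hh.fderiv_right (m := 1) (by norm_num)).differentiable (by norm_num)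
  have hg' : ∀ t : ℝ, HasDerivAt (fun t : ℝ => fderiv ℝ h (x + t • e) e)
      (iteratedFDeriv ℝ 2 h (x + t • e) ![e, e]) t := by
    intro t
    have := ((hd _).hasFDerivAt.comp_hasDerivAt t (hl t)).clm_apply (hasDerivAt_const t e)
    simpa [iteratedFDeriv_two_apply] using this
  have hlip' : ∀ s t : ℝ, |iteratedFDeriv ℝ 2 h (x + s • e) ![e, e]
      - iteratedFDeriv ℝ 2 h (x + t • e) ![e, e]| ≤ M * |s - t| := by
    intro s t
    have h1 := (iteratedFDeriv ℝ 2 h (x + s • e)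
      - iteratedFDeriv ℝ 2 h (x + t • e)).le_opNorm ![e, e]
    have h2 := hlip (x + s • e) (x + t • e)
    rw [add_sub_add_left_eq_sub, ← sub_smul, norm_smul, he, mul_one, Real.norm_eq_abs] at h2
    simp [Fin.prod_univ_two, he] at h1
    exact h1.trans h2
  have u := central_difference_le hν hg hg' hlip'
  have l := central_difference_le hν (fun t => (hg t).neg) (fun t => (hg' t).neg)
    (fun s t => by simpa [abs_sub_comm, neg_add_eq_sub] using hlip' t s)
  simp only [Pi.neg_apply, neg_smul, ← sub_eq_add_neg, zero_smul, add_zero] at u l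
  have key : (h (x + ν • e) - h (x - ν • e)) / (2 * ν) - fderiv ℝ h x e
      = (h (x + ν • e) - h (x - ν • e) - 2 * ν * fderiv ℝ h x e) / (2 * ν) := by
    field_simp
  rw [key, abs_div, abs_of_pos (by positivity : 0 < 2 * ν), div_le_iff₀ (by positivity), abs_le]
  constructor <;> linarith

/-- Error of the central finite-difference gradient for a function with Lipschitz Hessian. -/
theorem norm_centralFDGrad_sub_gradient_sq_le {d : ℕ} {h : EuclideanSpace ℝ (Fin d) → ℝ}
    {M ν : ℝ} (hν : 0 < ν) (hh : ContDiff ℝ 2 h)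
    (hlip : ∀ x y, ‖iteratedFDeriv ℝ 2 h x - iteratedFDeriv ℝ 2 h y‖ ≤ M * ‖x - y‖)
    (x : EuclideanSpace ℝ (Fin d)) :
    ‖centralFDGrad d ν h x - gradient h x‖ ^ 2 ≤ d * (M * ν ^ 2 / 6) ^ 2 := by
  have hgrad : ∀ j, gradient h x j = fderiv ℝ h x (EuclideanSpace.single j 1) := by
    intro j
    rw [← InnerProductSpace.toDual_symm_apply, EuclideanSpace.inner_single_right]
    simp [gradient]
  have hcoord : ∀ j, (centralFDGrad d ν h x - gradient h x) j
      = (h (x + ν • EuclideanSpace.single j (1 : ℝ)) - h (x - ν • EuclideanSpace.single j (1 : ℝ)))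
        / (2 * ν) - fderiv ℝ h x (EuclideanSpace.single j 1) := by
    intro j
    rw [PiLp.sub_apply, hgrad]
    simp [centralFDGrad, Pi.single_apply]
  rw [EuclideanSpace.norm_sq_eq]
  calc ∑ j, ‖(centralFDGrad d ν h x - gradient h x) j‖ ^ 2
      ≤ ∑ _j : Fin d, (M * ν ^ 2 / 6) ^ 2 := by
        refine Finset.sum_le_sum fun j _ => pow_le_pow_left₀ (norm_nonneg _) ?_ 2
        rw [hcoord]
        exact abs_central_quotient_sub_fderiv_le hν hh hlip x _ (by simp)
    _ = d * (M * ν ^ 2 / 6) ^ 2 := by simp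

theorem norm_add_sq_le_two_mul {E : Type*} [SeminormedAddCommGroup E] (a b : E) :
    ‖a + b‖ ^ 2 ≤ 2 * ‖a‖ ^ 2 + 2 * ‖b‖ ^ 2 := by
  have h := pow_le_pow_left₀ (norm_nonneg _) (norm_add_le a b) 2
  nlinarith [sq_nonneg (‖a‖ - ‖b‖)]

theorem adaptive_sample_size_bound_cFD
    (d : ℕ) (hd : 1 ≤ d)
    {Ω : Type*} [MeasurableSpace Ω] (μ : Measure Ω) [IsProbabilityMeasure μ]
    (f : EuclideanSpace ℝ (Fin d) → Ω → ℝ)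
    (F : EuclideanSpace ℝ (Fin d) → ℝ) (Mf MF : ℝ)
    (hMf : 0 ≤ Mf) (hMF : 0 ≤ MF) (hMFf : MF ≤ Mf)
    (hf : ∀ ω, ContDiff ℝ 2 (fun y => f y ω))
    (hLipf : ∀ ω, ∀ x y : EuclideanSpace ℝ (Fin d),
      ‖iteratedFDeriv ℝ 2 (fun z => f z ω) x - iteratedFDeriv ℝ 2 (fun z => f z ω) y‖
        ≤ Mf * ‖x - y‖)
    (hF : ContDiff ℝ 2 F)
    (hLipF : ∀ x y : EuclideanSpace ℝ (Fin d),
      ‖iteratedFDeriv ℝ 2 F x - iteratedFDeriv ℝ 2 F y‖ ≤ MF * ‖x - y‖)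
    (β₁ β₂ : ℝ) (hβ₁ : 0 ≤ β₁) (hβ₂ : 0 ≤ β₂)
    (hgradInt : ∀ y : EuclideanSpace ℝ (Fin d),
      Integrable (fun ω => gradient (fun z => f z ω) y) μ)
    (hmean : ∀ y : EuclideanSpace ℝ (Fin d),
      (∫ ω, gradient (fun z => f z ω) y ∂μ) = gradient F y)
    (hvarInt : ∀ y : EuclideanSpace ℝ (Fin d),
      Integrable (fun ω => ‖gradient (fun z => f z ω) y - gradient F y‖ ^ 2) μ)
    (hvar : ∀ y : EuclideanSpace ℝ (Fin d),
      (∫ ω, ‖gradient (fun z => f z ω) y - gradient F y‖ ^ 2 ∂μ)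
        ≤ β₁ * ‖gradient F y‖ ^ 2 + β₂)
    (x : EuclideanSpace ℝ (Fin d)) (ν θ ε' : ℝ) (hν : 0 < ν) (hθ : 0 < θ) (hε' : 0 < ε')
    (hInt : Integrable
      (fun ω => ‖centralFDGrad d ν (fun z => f z ω) x - centralFDGrad d ν F x‖ ^ 2) μ)
    (hbig : ε' < ‖centralFDGrad d ν F x‖ ^ 2) :
    (⌈(∫ ω, ‖centralFDGrad d ν (fun z => f z ω) x - centralFDGrad d ν F x‖ ^ 2 ∂μ)
        / (θ ^ 2 * ‖centralFDGrad d ν F x‖ ^ 2)⌉₊ : ℝ)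
      ≤ (1 + 4 * β₁ / θ ^ 2)
        + (2 * β₂ / θ ^ 2 + (2 + β₁) * Mf ^ 2 * ν ^ 4 * d / (9 * θ ^ 2)) / ε' := by
  set B : ℝ := d * (Mf * ν ^ 2 / 6) ^ 2 with hB
  set A : ℝ := ‖centralFDGrad d ν F x‖ ^ 2 with hA
  have hbF : ‖centralFDGrad d ν F x - gradient F x‖ ^ 2 ≤ B :=
    norm_centralFDGrad_sub_gradient_sq_le hν hF
      (fun y z => (hLipF y z).trans (mul_le_mul_of_nonneg_right hMFf (norm_nonneg _))) x
  have hpt : ∀ ω, ‖centralFDGrad d ν (fun z => f z ω) x - centralFDGrad d ν F x‖ ^ 2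
      ≤ 2 * ‖gradient (fun z => f z ω) x - gradient F x‖ ^ 2 + 8 * B := by
    intro ω
    have hbf := norm_centralFDGrad_sub_gradient_sq_le hν (hf ω) (hLipf ω) x
    have h1 := norm_add_sq_le_two_mul (gradient (fun z => f z ω) x - gradient F x)
      ((centralFDGrad d ν (fun z => f z ω) x - gradient (fun z => f z ω) x)
        + -(centralFDGrad d ν F x - gradient F x))
    have h2 := norm_add_sq_le_two_mul
      (centralFDGrad d ν (fun z => f z ω) x - gradient (fun z => f z ω) x)
      (-(centralFDGrad d ν F x - gradient F x))
    rw [norm_neg] at h2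
    have e : centralFDGrad d ν (fun z => f z ω) x - centralFDGrad d ν F x
        = (gradient (fun z => f z ω) x - gradient F x)
          + ((centralFDGrad d ν (fun z => f z ω) x - gradient (fun z => f z ω) x)
            + -(centralFDGrad d ν F x - gradient F x)) := by abel
    rw [e]
    linarith
  have hgF : ‖gradient F x‖ ^ 2 ≤ 2 * A + 2 * B := by
    have h1 := norm_add_sq_le_two_mul (centralFDGrad d ν F x)
      (-(centralFDGrad d ν F x - gradient F x))
    rw [norm_neg, show centralFDGrad d ν F x + -(centralFDGrad d ν F x - gradient F x)
      = gradient F x by abel] at h1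
    linarith
  have hE : (∫ ω, ‖centralFDGrad d ν (fun z => f z ω) x - centralFDGrad d ν F x‖ ^ 2 ∂μ)
      ≤ 4 * β₁ * A + (2 * β₂ + (2 + β₁) * Mf ^ 2 * ν ^ 4 * d / 9) := by
    have h1 := integral_mono hInt (((hvarInt x).const_mul 2).add (integrable_const (8 * B))) hpt
    simp only [Pi.add_apply] at h1
    rw [integral_add ((hvarInt x).const_mul 2) (integrable_const _), integral_const_mul] at h1
    simp only [integral_const, probReal_univ, one_smul] at h1
    have h2 := mul_le_mul_of_nonneg_left hgF hβ₁
    have h3 := hvar x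
    have h4 : (2 + β₁) * Mf ^ 2 * ν ^ 4 * d / 9 = (8 + 4 * β₁) * B := by rw [hB]; ring
    rw [h4]
    linarith
  have hA0 : 0 < A := hε'.trans hbig
  have hc : 0 ≤ 2 * β₂ + (2 + β₁) * Mf ^ 2 * ν ^ 4 * d / 9 := by positivity
  refine (Nat.ceil_lt_add_one (div_nonneg (integral_nonneg fun ω => sq_nonneg _)
    (by positivity))).le.trans ?_
  calc _ ≤ (4 * β₁ * A + (2 * β₂ + (2 + β₁) * Mf ^ 2 * ν ^ 4 * d / 9)) / (θ ^ 2 * A) + 1 := by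
        gcongr
    _ = 1 + 4 * β₁ / θ ^ 2
        + (2 * β₂ + (2 + β₁) * Mf ^ 2 * ν ^ 4 * d / 9) / θ ^ 2 / A := by
        field_simp
        ring
    _ ≤ 1 + 4 * β₁ / θ ^ 2
        + (2 * β₂ + (2 + β₁) * Mf ^ 2 * ν ^ 4 * d / 9) / θ ^ 2 / ε' := by
        gcongr
    _ = _ := by
        field_simp
end

section
/- Let d ≥ 1 and 1 ≤ N ≤ d. Let (Ω, μ) be a probability space and f : ℝ^d × Ω → ℝ be such that for every ω the function f(·, ω) is twice continuously differentiable with M_f-Lipschitz Hessian; let F : ℝ^d → ℝ be twice continuously differentiable with M_F-Lipschitz Hessian where M_F ≤ M_f; assume E_ω[∇f(x, ω)] = ∇F(x) and E_ω[‖∇f(x, ω) − ∇F(x)‖²] ≤ β₁‖∇F(x)‖² + β₂ for constants β₁, β₂ ≥ 0. Fix x ∈ ℝ^d and ν > 0, define ∇^{FD}h(x) := ∑_{j=1}^d ((h(x + νe_j) − h(x − νe_j))/(2ν)) e_j, and for each j define c_j(ω) := (f(x + νe_j, ω) − f(x − νe_j, ω))/(2ν) − (F(x + νe_j) − F(x −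 νe_j))/(2ν). Then, averaging uniformly over all N-element subsets T of {1, …, d}: (1 / C(d,N)) ∑_{|T| = N} E_ω[‖(d/N) ∑_{j ∈ T} c_j(ω) e_j‖²] ≤ (4β₁ d / N) ‖∇^{FD}F(x)‖² + 2β₂ d / N + (2 + β₁) M_f² ν⁴ d² / (9N). -/
open MeasureTheory

/-- The error of the central finite difference along a unit vector `e`, for a function whose
second derivative is `M`-Lipschitz. -/
lemma abs_central_difference_sub_fderiv_le {E : Type*} [NormedAddCommGroup E] [NormedSpace ℝ E]
    {h : E → ℝ} {M : ℝ} (hh : ContDiff ℝ 2 h)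
    (hLip : ∀ x y : E, ‖iteratedFDeriv ℝ 2 h x - iteratedFDeriv ℝ 2 h y‖ ≤ M * ‖x - y‖)
    (x e : E) (he : ‖e‖ = 1) {ν : ℝ} (hν : 0 < ν) :
    |(h (x + ν • e) - h (x - ν • e)) / (2 * ν) - fderiv ℝ h x e| ≤ M * ν ^ 2 / 6 := by
  have hd1 : Differentiable ℝ h := hh.differentiable (by norm_num)
  have hd2 : Differentiable ℝ (fderiv ℝ h) :=
    (hh.fderiv_right (m := 1) (by norm_num)).differentiable (by norm_num)
  have hline : ∀ s t : ℝ, HasDerivAt (fun t : ℝ => x + (s * t) • e) (s • e) t := fun s t => by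
    simpa using (((hasDerivAt_id t).const_mul s).smul_const e).const_add x
  have hφ : ∀ s t : ℝ, HasDerivAt (fun t : ℝ => h (x + (s * t) • e))
      (s * fderiv ℝ h (x + (s * t) • e) e) t := fun s t => by
    simpa [Function.comp_def] using (hd1 _).hasFDerivAt.comp_hasDerivAt t (hline s t)
  have hφ' : ∀ s t : ℝ, HasDerivAt (fun t : ℝ => fderiv ℝ h (x + (s * t) • e) e)
      (s * fderiv ℝ (fderiv ℝ h) (x + (s * t) • e) e e) t := fun s t => by
    simpa using ((hd2 _).hasFDerivAt.comp_hasDerivAt t (hline s t)).clm_apply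
      (hasDerivAt_const t e)
  have hsecond : ∀ t : ℝ, 0 ≤ t →
      ‖(1 : ℝ) * fderiv ℝ (fderiv ℝ h) (x + (1 * t) • e) e e
        + -1 * fderiv ℝ (fderiv ℝ h) (x + (-1 * t) • e) e e‖ ≤ M * (2 * t) := fun t ht => by
    have h1 := (iteratedFDeriv ℝ 2 h (x + (1 * t) • e)
      - iteratedFDeriv ℝ 2 h (x + (-1 * t) • e)).le_opNorm ![e, e]
    have h2 := hLip (x + (1 * t) • e) (x + (-1 * t) • e)
    have h3 : x + (1 * t) • e - (x + (-1 * t) • e) = (2 * t) • e := by module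
    rw [h3, norm_smul, he, Real.norm_of_nonneg (by positivity), mul_one] at h2
    simp only [sub_apply, iteratedFDeriv_two_apply,
      Fin.prod_univ_two, Matrix.cons_val_zero, Matrix.cons_val_one, he, mul_one] at h1
    refine le_trans (le_of_eq ?_) (h1.trans h2)
    congr 1
    ring
  have hψ' : ∀ t : ℝ, HasDerivAt (fun t : ℝ => fderiv ℝ h (x + (1 * t) • e) e
      + fderiv ℝ h (x + (-1 * t) • e) e - 2 * fderiv ℝ h x e)
      ((1 : ℝ) * fderiv ℝ (fderiv ℝ h) (x + (1 * t) • e) e e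
        + -1 * fderiv ℝ (fderiv ℝ h) (x + (-1 * t) • e) e e) t := fun t =>
    ((hφ' 1 t).add (hφ' (-1) t)).sub_const _
  have hψ : ∀ t : ℝ, HasDerivAt (fun t : ℝ => h (x + (1 * t) • e) - h (x + (-1 * t) • e)
      - t * (2 * fderiv ℝ h x e)) (fderiv ℝ h (x + (1 * t) • e) e
      + fderiv ℝ h (x + (-1 * t) • e) e - 2 * fderiv ℝ h x e) t := fun t => by
    refine (((hφ 1 t).sub (hφ (-1) t)).sub
      ((hasDerivAt_id t).mul_const (2 * fderiv ℝ h x e))).congr_deriv ?_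
    ring
  have hfirst : ∀ t ∈ Set.Icc 0 ν, ‖fderiv ℝ h (x + (1 * t) • e) e
      + fderiv ℝ h (x + (-1 * t) • e) e - 2 * fderiv ℝ h x e‖ ≤ M * t ^ 2 := by
    refine fun t ht => image_norm_le_of_norm_deriv_right_le_deriv_boundary
      (B := fun t => M * t ^ 2) (B' := fun t => M * (2 * t))
      (fun t _ => (hψ' t).continuousAt.continuousWithinAt)
      (fun t _ => (hψ' t).hasDerivWithinAt) ?_ (fun t => ?_)
      (fun t ht => hsecond t ht.1) ht
    · simp [two_mul]
    · simpa using (hasDerivAt_pow 2 t).const_mul M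
  have hzero := image_norm_le_of_norm_deriv_right_le_deriv_boundary
    (B := fun t => M * (t ^ 3 / 3)) (B' := fun t => M * t ^ 2)
    (fun t _ => (hψ t).continuousAt.continuousWithinAt)
    (fun t _ => (hψ t).hasDerivWithinAt) (by simp)
    (fun t => by
      refine (((hasDerivAt_pow 3 t).div_const 3).const_mul M).congr_deriv ?_
      norm_num)
    (fun t ht => hfirst t ⟨ht.1, ht.2.le⟩) (Set.right_mem_Icc.2 hν.le)
  have heq : (h (x + ν • e) - h (x - ν • e)) / (2 * ν) - fderiv ℝ h x e
      = (h (x + (1 * ν) • e) - h (x + (-1 * ν) • e) - ν * (2 * fderiv ℝ h x e)) / (2 * ν) := by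
    rw [one_mul, neg_one_mul, neg_smul, ← sub_eq_add_neg]
    field_simp
  rw [heq, abs_div, abs_of_pos (by positivity : 0 < 2 * ν), div_le_iff₀ (by positivity)]
  refine hzero.trans (le_of_eq ?_)
  ring

lemma fderiv_single_eq_gradient_apply {d : ℕ} {h : EuclideanSpace ℝ (Fin d) → ℝ}
    {x : EuclideanSpace ℝ (Fin d)} (hh : DifferentiableAt ℝ h x) (j : Fin d) :
    fderiv ℝ h x (EuclideanSpace.single j (1 : ℝ)) = gradient h x j := by
  rw [hh.hasGradientAt.hasFDerivAt.fderiv, InnerProductSpace.toDual_apply_apply,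
    EuclideanSpace.inner_single_right]
  simp

lemma sum_smul_single_apply {d : ℕ} (T : Finset (Fin d)) (a : Fin d → ℝ) (i : Fin d) :
    (∑ j ∈ T, a j • EuclideanSpace.single j (1 : ℝ)) i = if i ∈ T then a i else 0 := by
  simp [Finset.sum_apply, Pi.single_apply]

lemma norm_sq_sum_smul_single {d : ℕ} (T : Finset (Fin d)) (a : Fin d → ℝ) :
    ‖∑ j ∈ T, a j • EuclideanSpace.single j (1 : ℝ)‖ ^ 2 = ∑ j ∈ T, a j ^ 2 := by
  simp [EuclideanSpace.real_norm_sq_eq, sum_smul_single_apply, ite_pow]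

/-- Summing `a` over all subsets of cardinality `k + 1`: each element lies in
`n.choose k` of them. -/
lemma sum_powersetCard_sum (k n : ℕ) (a : Fin (n + 1) → ℝ) :
    ∑ T ∈ Finset.powersetCard (k + 1) (Finset.univ : Finset (Fin (n + 1))), ∑ j ∈ T, a j
      = n.choose k * ∑ j, a j := by
  have hcount (j : Fin (n + 1)) :
      ((Finset.powersetCard (k + 1) (Finset.univ : Finset (Fin (n + 1)))).filter
        (j ∈ ·)).card = n.choose k := by
    have h := Finset.card_filter_add_card_filter_not
      (s := Finset.powersetCard (k + 1) (Finset.univ : Finset (Fin (n + 1)))) (j ∈ ·)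
    have h' : (Finset.powersetCard (k + 1) (Finset.univ : Finset (Fin (n + 1)))).filter (j ∉ ·)
        = Finset.powersetCard (k + 1) (Finset.univ.erase j) := by
      ext T
      simp only [Finset.mem_filter, Finset.mem_powersetCard, Finset.subset_univ, true_and,
        Finset.subset_erase]
      tauto
    rw [h', Finset.card_powersetCard, Finset.card_powersetCard,
      Finset.card_erase_of_mem (Finset.mem_univ j), Finset.card_univ, Fintype.card_fin,
      Nat.add_sub_cancel, Nat.choose_succ_succ'] at h
    omega
  calc _ = ∑ T ∈ Finset.powersetCard (k + 1) (Finset.univ : Finset (Fin (n + 1))),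
        ∑ j, if j ∈ T then a j else 0 := by simp
    _ = _ := by
      rw [Finset.sum_comm, Finset.mul_sum]
      refine Finset.sum_congr rfl fun j _ => ?_
      rw [← Finset.sum_filter, Finset.sum_const, hcount, nsmul_eq_mul]

lemma average_powersetCard_sum {d N : ℕ} (hN : 1 ≤ N) (hNd : N ≤ d) (a : Fin d → ℝ) :
    (1 / (d.choose N : ℝ)) *
        ∑ T ∈ Finset.powersetCard N (Finset.univ : Finset (Fin d)), ∑ j ∈ T, a j
      = (N / d : ℝ) * ∑ j, a j := by
  obtain ⟨k, rfl⟩ : ∃ k, N = k + 1 := ⟨N - 1, by omega⟩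
  obtain ⟨n, rfl⟩ : ∃ n, d = n + 1 := ⟨d - 1, by omega⟩
  rw [sum_powersetCard_sum k n a, ← mul_assoc]
  congr 1
  have hpos : (0 : ℝ) < (n + 1).choose (k + 1) := by exact_mod_cast Nat.choose_pos hNd
  have h : ((n + 1 : ℕ) : ℝ) * n.choose k = (n + 1).choose (k + 1) * ((k + 1 : ℕ) : ℝ) := by
    exact_mod_cast Nat.add_one_mul_choose_eq n k
  field_simp
  linarith

/-- The squared norm of a gradient is controlled by its central finite-difference estimator. -/
lemma norm_gradient_sq_le_centralFDGrad {d : ℕ} {h : EuclideanSpace ℝ (Fin d) → ℝ} {M : ℝ}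
    (hh : ContDiff ℝ 2 h)
    (hLip : ∀ x y : EuclideanSpace ℝ (Fin d),
      ‖iteratedFDeriv ℝ 2 h x - iteratedFDeriv ℝ 2 h y‖ ≤ M * ‖x - y‖)
    (x : EuclideanSpace ℝ (Fin d)) {ν : ℝ} (hν : 0 < ν) :
    ‖gradient h x‖ ^ 2 ≤ 2 * ‖centralFDGrad d ν h x‖ ^ 2 + d * (M ^ 2 * ν ^ 4 / 18) := by
  have key : ∀ j : Fin d, gradient h x j ^ 2 ≤
      2 * ((h (x + ν • EuclideanSpace.single j (1 : ℝ))
        - h (x - ν • EuclideanSpace.single j (1 : ℝ))) / (2 * ν)) ^ 2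
        + M ^ 2 * ν ^ 4 / 18 := fun j => by
    have h1 := abs_central_difference_sub_fderiv_le hh hLip x
      (EuclideanSpace.single j (1 : ℝ)) (by simp) hν
    rw [fderiv_single_eq_gradient_apply (hh.differentiable (by norm_num) x)] at h1
    have h2 := sq_le_sq' (abs_le.1 h1).1 (abs_le.1 h1).2
    nlinarith [sq_nonneg (2 * ((h (x + ν • EuclideanSpace.single j (1 : ℝ))
        - h (x - ν • EuclideanSpace.single j (1 : ℝ))) / (2 * ν)) - gradient h x j)]
  rw [centralFDGrad, norm_sq_sum_smul_single, EuclideanSpace.real_norm_sq_eq]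
  refine (Finset.sum_le_sum fun j _ => key j).trans (le_of_eq ?_)
  rw [Finset.sum_add_distrib, ← Finset.mul_sum]
  simp

theorem randomized_coordinate_central_fd_sampling_error_bound
    (d N : ℕ) (hd : 1 ≤ d) (hN : 1 ≤ N) (hNd : N ≤ d)
    {Ω : Type*} [MeasurableSpace Ω] (μ : Measure Ω) [IsProbabilityMeasure μ]
    (f : EuclideanSpace ℝ (Fin d) → Ω → ℝ)
    (F : EuclideanSpace ℝ (Fin d) → ℝ) (Mf MF : ℝ)
    (hMf : 0 ≤ Mf) (hMF : 0 ≤ MF) (hMFf : MF ≤ Mf)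
    (hf : ∀ ω, ContDiff ℝ 2 (fun y => f y ω))
    (hLipf : ∀ ω, ∀ x y : EuclideanSpace ℝ (Fin d),
      ‖iteratedFDeriv ℝ 2 (fun z => f z ω) x - iteratedFDeriv ℝ 2 (fun z => f z ω) y‖
        ≤ Mf * ‖x - y‖)
    (hF : ContDiff ℝ 2 F)
    (hLipF : ∀ x y : EuclideanSpace ℝ (Fin d),
      ‖iteratedFDeriv ℝ 2 F x - iteratedFDeriv ℝ 2 F y‖ ≤ MF * ‖x - y‖)
    (β₁ β₂ : ℝ) (hβ₁ : 0 ≤ β₁) (hβ₂ : 0 ≤ β₂)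
    (hgradInt : ∀ y : EuclideanSpace ℝ (Fin d),
      Integrable (fun ω => gradient (fun z => f z ω) y) μ)
    (hmean : ∀ y : EuclideanSpace ℝ (Fin d),
      (∫ ω, gradient (fun z => f z ω) y ∂μ) = gradient F y)
    (hvarInt : ∀ y : EuclideanSpace ℝ (Fin d),
      Integrable (fun ω => ‖gradient (fun z => f z ω) y - gradient F y‖ ^ 2) μ)
    (hvar : ∀ y : EuclideanSpace ℝ (Fin d),
      (∫ ω, ‖gradient (fun z => f z ω) y - gradient F y‖ ^ 2 ∂μ)
        ≤ β₁ * ‖gradient F y‖ ^ 2 + β₂)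
    (x : EuclideanSpace ℝ (Fin d)) (ν : ℝ) (hν : 0 < ν)
    (c : Fin d → Ω → ℝ)
    (hc : ∀ j ω, c j ω =
      (f (x + ν • EuclideanSpace.single j (1 : ℝ)) ω
          - f (x - ν • EuclideanSpace.single j (1 : ℝ)) ω) / (2 * ν)
        - (F (x + ν • EuclideanSpace.single j (1 : ℝ))
          - F (x - ν • EuclideanSpace.single j (1 : ℝ))) / (2 * ν))
    (hInt : ∀ T : Finset (Fin d),
      Integrable (fun ω =>
        ‖((d : ℝ) / (N : ℝ)) • ∑ j ∈ T, c j ω • EuclideanSpace.single j (1 : ℝ)‖ ^ 2) μ) :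
    (1 / (d.choose N : ℝ)) *
        ∑ T ∈ Finset.powersetCard N (Finset.univ : Finset (Fin d)),
          ∫ ω, ‖((d : ℝ) / (N : ℝ)) • ∑ j ∈ T, c j ω • EuclideanSpace.single j (1 : ℝ)‖ ^ 2 ∂μ
      ≤ (4 * β₁ * d / N) * ‖centralFDGrad d ν F x‖ ^ 2
        + 2 * β₂ * d / N + (2 + β₁) * Mf ^ 2 * ν ^ 4 * d ^ 2 / (9 * N) := by
  have hd0 : (0 : ℝ) < d := by exact_mod_cast hd
  have hN0 : (0 : ℝ) < N := by exact_mod_cast hN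
  have hnorm : ∀ (T : Finset (Fin d)) ω,
      ‖((d : ℝ) / (N : ℝ)) • ∑ j ∈ T, c j ω • EuclideanSpace.single j (1 : ℝ)‖ ^ 2
        = ((d : ℝ) / N) ^ 2 * ∑ j ∈ T, c j ω ^ 2 := fun T ω => by
    rw [norm_smul, mul_pow, norm_sq_sum_smul_single T (c · ω), Real.norm_eq_abs, sq_abs]
  have hcInt : ∀ j, Integrable (fun ω => c j ω ^ 2) μ := fun j => by
    have h := (hInt {j}).const_mul ((((d : ℝ) / N) ^ 2)⁻¹)
    refine h.congr (Filter.Eventually.of_forall fun ω => ?_)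
    simp only [hnorm {j} ω]
    rw [Finset.sum_singleton]
    field_simp
  have hcoord : ∀ j ω, c j ω ^ 2 ≤
      2 * (gradient (fun z => f z ω) x - gradient F x) j ^ 2 + 2 * (Mf ^ 2 * ν ^ 4 / 9) := by
    intro j ω
    have h1 := abs_central_difference_sub_fderiv_le (hf ω) (hLipf ω) x
      (EuclideanSpace.single j (1 : ℝ)) (by simp) hν
    have h2 := abs_central_difference_sub_fderiv_le hF hLipF x
      (EuclideanSpace.single j (1 : ℝ)) (by simp) hν
    rw [fderiv_single_eq_gradient_apply ((hf ω).differentiable (by norm_num) x)] at h1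
    rw [fderiv_single_eq_gradient_apply (hF.differentiable (by norm_num) x)] at h2
    have hM : MF * ν ^ 2 ≤ Mf * ν ^ 2 := by gcongr
    obtain ⟨h1l, h1u⟩ := abs_le.1 h1
    obtain ⟨h2l, h2u⟩ := abs_le.1 h2
    have hcj := hc j ω
    have h3 := sq_le_sq' (a := c j ω - (gradient (fun z => f z ω) x - gradient F x) j)
      (b := Mf * ν ^ 2 / 3)
      (by simp only [PiLp.sub_apply]; linarith) (by simp only [PiLp.sub_apply]; linarith)
    nlinarith [sq_nonneg (c j ω - 2 * (gradient (fun z => f z ω) x - gradient F x) j)]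
  have hsum : ∑ j, ∫ ω, c j ω ^ 2 ∂μ
      ≤ 2 * (β₁ * ‖gradient F x‖ ^ 2 + β₂) + d * (2 * (Mf ^ 2 * ν ^ 4 / 9)) := by
    rw [← integral_finsetSum _ fun j _ => hcInt j]
    calc _ ≤ ∫ ω, (2 * ‖gradient (fun z => f z ω) x - gradient F x‖ ^ 2
          + d * (2 * (Mf ^ 2 * ν ^ 4 / 9))) ∂μ := by
          refine integral_mono (integrable_finsetSum _ fun j _ => hcInt j)
            (((hvarInt x).const_mul 2).add (integrable_const _)) fun ω => ?_
          refine (Finset.sum_le_sum fun j _ => hcoord j ω).trans (le_of_eq ?_)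
          rw [Finset.sum_add_distrib, ← Finset.mul_sum, EuclideanSpace.real_norm_sq_eq]
          simp
      _ = 2 * (∫ ω, ‖gradient (fun z => f z ω) x - gradient F x‖ ^ 2 ∂μ)
          + d * (2 * (Mf ^ 2 * ν ^ 4 / 9)) := by
          rw [integral_add ((hvarInt x).const_mul 2) (integrable_const _),
            integral_const_mul, integral_const]
          simp
      _ ≤ _ := by gcongr; exact hvar x
  have hgrad : ‖gradient F x‖ ^ 2
      ≤ 2 * ‖centralFDGrad d ν F x‖ ^ 2 + d * (Mf ^ 2 * ν ^ 4 / 18) := by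
    refine (norm_gradient_sq_le_centralFDGrad hF hLipF x hν).trans ?_
    gcongr
  have hlhs : (1 / (d.choose N : ℝ)) *
        ∑ T ∈ Finset.powersetCard N (Finset.univ : Finset (Fin d)),
          ∫ ω, ‖((d : ℝ) / (N : ℝ)) • ∑ j ∈ T, c j ω • EuclideanSpace.single j (1 : ℝ)‖ ^ 2 ∂μ
      = (d / N : ℝ) * ∑ j, ∫ ω, c j ω ^ 2 ∂μ := by
    have hT : ∀ T : Finset (Fin d),
        ∫ ω, ‖((d : ℝ) / (N : ℝ)) • ∑ j ∈ T, c j ω • EuclideanSpace.single j (1 : ℝ)‖ ^ 2 ∂μ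
          = ((d : ℝ) / N) ^ 2 * ∑ j ∈ T, ∫ ω, c j ω ^ 2 ∂μ := fun T => by
      simp_rw [hnorm]
      rw [integral_const_mul, integral_finsetSum _ fun j _ => hcInt j]
    simp_rw [hT]
    rw [← Finset.mul_sum, mul_left_comm, average_powersetCard_sum hN hNd]
    field_simp
  rw [hlhs]
  calc _ ≤ (d / N : ℝ) * (2 * (β₁ * (2 * ‖centralFDGrad d ν F x‖ ^ 2
          + d * (Mf ^ 2 * ν ^ 4 / 18)) + β₂) + d * (2 * (Mf ^ 2 * ν ^ 4 / 9))) := by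
        gcongr
        refine hsum.trans ?_
        gcongr
    _ = _ := by
        field_simp
        ring
end
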